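/- The chromatic symmetric function of the chair (fork) graph is e_{2,2,1} + 2 e_{3,1,1} + e_{3,2} + 7 e_{4,1} + 5 e_5; in particular the chair is e-positive even though it contains an induced claw, so e-positivity is not a hereditary graph property. -/

import Mathlib

open SimpleGraph Finset
open scoped Classical

/-- `H` occurs as an induced subgraph of `G`. -/
def HasInducedCopy {V W : Type*} (G : SimpleGraph V) (H : SimpleGraph W) : Prop :=
  ∃ f : W ↪ V, ∀ a b, H.Adj a b ↔ G.Adj (f a) (f b)

/-- The graph on `Fin n` with the given edge list. -/
def listGraph (n : ℕ) (l : List (Fin n × Fin n)) : SimpleGraph (Fin n) :=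
  SimpleGraph.fromRel (fun a b => (a, b) ∈ l)

/-- The claw `K_{1,3}`. -/
def clawGraph : SimpleGraph (Fin 4) := listGraph 4 [(0,1),(0,2),(0,3)]

/-- The net: a triangle `0,1,2` with pendants `3,4,5`. -/
def netGraph : SimpleGraph (Fin 6) := listGraph 6 [(0,1),(0,2),(1,2),(0,3),(1,4),(2,5)]

/-- The chromatic symmetric function of a finite graph, as a formal power
series in the commuting variables `x_0, x_1, x_2, …`: the coefficient of the
monomial `x^α` is the number of proper colorings `κ : V → ℕ` whose color
classes have the sizes prescribed by `α`. -/
noncomputable def csf {V : Type*} [Fintype V] (G : SimpleGraph V) : MvPowerSeries ℕ ℚ :=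
  fun α => (Nat.card {κ : V → ℕ // (∀ ⦃u v⦄, G.Adj u v → κ u ≠ κ v) ∧
      ∀ i : ℕ, Nat.card {v : V // κ v = i} = α i} : ℚ)

/-- The elementary symmetric function `e_k` in the variables `x_0, x_1, …`:
the sum of all squarefree monomials of degree `k`. -/
noncomputable def esym (k : ℕ) : MvPowerSeries ℕ ℚ :=
  fun α => if (∀ i, α i ≤ 1) ∧ (α.sum fun _ m => m) = k then 1 else 0

/-- The elementary symmetric function `e_λ` for a partition `λ` of `n`. -/
noncomputable def esymPart {n : ℕ} (μ : Nat.Partition n) : MvPowerSeries ℕ ℚ :=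
  (μ.parts.map esym).prod

/-- A finite graph is `e`-positive if its chromatic symmetric function is a
nonnegative linear combination of the `e_λ`, `λ ⊢ |V|`. -/
def EPositive {V : Type*} [Fintype V] (G : SimpleGraph V) : Prop :=
  ∃ c : Nat.Partition (Fintype.card V) → ℚ,
    (∀ μ, 0 ≤ c μ) ∧ csf G = ∑ μ : Nat.Partition (Fintype.card V), c μ • esymPart μ

/-- The chair (fork) graph: the path `0-1-2-3` with a pendant vertex `4`
attached to `1`. -/
def chairGraph : SimpleGraph (Fin 5) := listGraph 5 [(0,1),(1,2),(2,3),(1,4)]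

open MvPowerSeries in
theorem MvPowerSeries.ext_killCompl {R : Type*} [CommSemiring R] {A B : MvPowerSeries ℕ R}
    (h : ∀ N : ℕ, killCompl (R := R) (Fin.valEmbedding (n := N)) A =
      killCompl (R := R) (Fin.valEmbedding (n := N)) B) : A = B := by
  ext α
  obtain ⟨N, hN⟩ : ∃ N, ∀ i ∈ α.support, i < N :=
    ⟨α.support.sup id + 1, fun i hi => Nat.lt_succ_of_le (Finset.le_sup (f := id) hi)⟩
  obtain ⟨u, rfl⟩ : α ∈ Set.range (Finsupp.embDomain (Fin.valEmbedding (n := N))) := by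
    exact ⟨_, Finsupp.embDomain_comapDomain fun i hi => ⟨⟨i, hN i hi⟩, rfl⟩⟩
  rw [← coeff_killCompl, ← coeff_killCompl, h N]

section Truncation

variable {σ : Type*} [Fintype σ]

theorem coeff_esymm_eq_ite (k : ℕ) (u : σ →₀ ℕ) :
    MvPolynomial.coeff u (MvPolynomial.esymm σ ℚ k) =
      if (∀ i, u i ≤ 1) ∧ (u.sum fun _ m => m) = k then 1 else 0 := by
  rw [MvPolynomial.esymm_eq_sum_monomial, MvPolynomial.coeff_sum]
  simp only [MvPolynomial.coeff_monomial]
  have key : ∀ t : Finset σ, (∑ i ∈ t, Finsupp.single i 1 = u) ↔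
      ((∀ i, u i ≤ 1) ∧ t = u.support) := by
    intro t
    have ht : ∀ j, (∑ i ∈ t, Finsupp.single i 1 : σ →₀ ℕ) j = if j ∈ t then 1 else 0 := by
      intro j
      simp [Finsupp.finsetSum_apply, Finsupp.single_apply]
    constructor
    · rintro rfl
      refine ⟨fun i => by rw [ht]; split_ifs <;> simp, ?_⟩
      ext j
      simp [ht]
    · rintro ⟨h1, rfl⟩
      ext j
      rw [ht]
      have := h1 j
      by_cases hj : u j = 0
      · simp [hj]
      · simp [hj]; omega
  simp only [key]
  by_cases h1 : ∀ i, u i ≤ 1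
  · have hs : (u.sum fun _ m => m) = #u.support := by
      rw [Finsupp.sum, Finset.card_eq_sum_ones]
      refine Finset.sum_congr rfl fun i hi => ?_
      have := h1 i
      have := Finsupp.mem_support_iff.1 hi
      omega
    simp [h1, hs, Finset.sum_ite_eq', Finset.mem_powersetCard]
  · simp [h1]

theorem killCompl_esym (e : σ ↪ ℕ) (k : ℕ) :
    MvPowerSeries.killCompl (R := ℚ) e (esym k) =
      (MvPolynomial.esymm σ ℚ k : MvPowerSeries σ ℚ) := by
  ext u
  rw [MvPowerSeries.coeff_killCompl, MvPolynomial.coeff_coe, coeff_esymm_eq_ite]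
  change (if _ then _ else _) = _
  have h : (∀ i, Finsupp.embDomain e u i ≤ 1) ↔ ∀ i, u i ≤ 1 := by
    refine ⟨fun h i => by simpa using h (e i), fun h i => ?_⟩
    by_cases hi : i ∈ Set.range e
    · obtain ⟨j, rfl⟩ := hi
      simpa using h j
    · simp [Finsupp.embDomain_of_notMem_range _ _ _ hi]
  have h2 : ((Finsupp.embDomain e u).sum fun _ m => m) = u.sum fun _ m => m := by
    simp [Finsupp.sum, Finsupp.support_embDomain, Finset.sum_map]
  simp only [h, h2]

/-- The chromatic symmetric polynomial of `G` in the variables indexed by `σ`. -/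
noncomputable def csfPoly (σ : Type*) [Fintype σ] {V : Type*} [Fintype V] [DecidableEq V]
    (G : SimpleGraph V) : MvPolynomial σ ℚ :=
  ∑ κ : V → σ, if ∀ ⦃u v⦄, G.Adj u v → κ u ≠ κ v then ∏ v, MvPolynomial.X (κ v) else 0

theorem killCompl_csf {V : Type*} [Fintype V] [DecidableEq V] (G : SimpleGraph V) (e : σ ↪ ℕ) :
    MvPowerSeries.killCompl (R := ℚ) e (csf G) = (csfPoly σ G : MvPowerSeries σ ℚ) := by
  ext u
  rw [MvPowerSeries.coeff_killCompl, MvPolynomial.coeff_coe, csfPoly, MvPolynomial.coeff_sum]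
  have hprod : ∀ κ : V → σ, (∏ v, MvPolynomial.X (κ v) : MvPolynomial σ ℚ) =
      MvPolynomial.monomial (∑ v, Finsupp.single (κ v) 1) 1 := fun κ => by
    simp [MvPolynomial.monomial_sum_one, MvPolynomial.X]
  have hfib : ∀ κ : V → σ, (∑ v, Finsupp.single (κ v) 1 = u) ↔
      ∀ i, Nat.card {v : V // κ v = i} = u i := fun κ => by
    rw [Finsupp.ext_iff]
    refine forall_congr' fun i => ?_
    rw [Nat.card_eq_fintype_card, Fintype.card_subtype, Finset.card_filter]
    simp [Finsupp.finsetSum_apply, Finsupp.single_apply]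
  have hterm : ∀ κ : V → σ, MvPolynomial.coeff u (if ∀ ⦃u v⦄, G.Adj u v → κ u ≠ κ v then
      ∏ v, MvPolynomial.X (κ v) else (0 : MvPolynomial σ ℚ)) =
      if (∀ ⦃u v⦄, G.Adj u v → κ u ≠ κ v) ∧ ∀ i, Nat.card {v : V // κ v = i} = u i
        then 1 else 0 := fun κ => by
    simp only [hprod, ← hfib]
    split_ifs <;> simp_all [MvPolynomial.coeff_monomial]
  rw [Finset.sum_congr rfl fun κ _ => hterm κ, Finset.sum_boole, ← Fintype.card_subtype,
    ← Nat.card_eq_fintype_card]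
  change ((Nat.card _ : ℕ) : ℚ) = _
  congr 1
  symm
  refine Nat.card_eq_of_bijective
    (fun κ => ⟨fun v => e (κ.1 v), fun a b h => e.injective.ne (κ.2.1 h), fun i => ?_⟩) ⟨?_, ?_⟩
  · by_cases hi : i ∈ Set.range e
    · obtain ⟨j, rfl⟩ := hi
      simpa using κ.2.2 j
    · rw [Finsupp.embDomain_of_notMem_range _ _ _ hi]
      have : IsEmpty {v : V // e (κ.1 v) = i} := ⟨fun v => hi ⟨_, v.2⟩⟩
      simp
  · intro κ κ' h
    ext v
    exact e.injective (congrFun (congrArg Subtype.val h) v)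
  · rintro ⟨κ, hκ, hα⟩
    have hr : ∀ v, ∃ j, e j = κ v := by
      intro v
      by_contra hv
      have h0 := hα (κ v)
      rw [Finsupp.embDomain_of_notMem_range _ _ _ hv] at h0
      have : Nonempty {w : V // κ w = κ v} := ⟨⟨v, rfl⟩⟩
      exact Nat.card_pos.ne' h0
    choose g hg using hr
    obtain rfl : (fun v => e (g v)) = κ := funext hg
    refine ⟨⟨g, fun a b h => fun hab => hκ h (congrArg e hab), fun i => ?_⟩, rfl⟩
    simpa using hα (e i)

end Truncation

theorem Fin.sum_pi_succ {ι M : Type*} [Fintype ι] [AddCommMonoid M] {n : ℕ}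
    (f : (Fin (n + 1) → ι) → M) :
    ∑ κ, f κ = ∑ a, ∑ κ : Fin n → ι, f (Matrix.vecCons a κ) := by
  rw [← Fintype.sum_prod_type', ← (Fin.consEquiv fun _ => ι).sum_comp]
  rfl

theorem Fin.sum_pi_four {ι M : Type*} [Fintype ι] [AddCommMonoid M] (f : (Fin 4 → ι) → M) :
    ∑ κ, f κ = ∑ a, ∑ b, ∑ c, ∑ d, f ![a, b, c, d] := by
  simp_rw [Fin.sum_pi_succ (n := 3), Fin.sum_pi_succ (n := 2), Fin.sum_pi_succ (n := 1),
    Fin.sum_pi_succ (n := 0)]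
  simp [Matrix.vecEmpty, Subsingleton.elim (default : Fin 0 → ι) Fin.elim0]

theorem Fin.sum_pi_five {ι M : Type*} [Fintype ι] [AddCommMonoid M] (f : (Fin 5 → ι) → M) :
    ∑ κ, f κ = ∑ a, ∑ b, ∑ c, ∑ d, ∑ e, f ![a, b, c, d, e] := by
  simp_rw [Fin.sum_pi_succ (n := 4), Fin.sum_pi_four]

theorem MvPolynomial.psum_eq_esymm (σ : Type*) [Fintype σ] :
    psum σ ℚ 1 = esymm σ ℚ 1 ∧
    psum σ ℚ 2 = esymm σ ℚ 1 ^ 2 - 2 * esymm σ ℚ 2 ∧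
    psum σ ℚ 3 = esymm σ ℚ 1 ^ 3 - 3 * esymm σ ℚ 1 * esymm σ ℚ 2 + 3 * esymm σ ℚ 3 ∧
    psum σ ℚ 4 = esymm σ ℚ 1 ^ 4 - 4 * esymm σ ℚ 1 ^ 2 * esymm σ ℚ 2 + 2 * esymm σ ℚ 2 ^ 2
      + 4 * esymm σ ℚ 1 * esymm σ ℚ 3 - 4 * esymm σ ℚ 4 ∧
    psum σ ℚ 5 = esymm σ ℚ 1 ^ 5 - 5 * esymm σ ℚ 1 ^ 3 * esymm σ ℚ 2
      + 5 * esymm σ ℚ 1 * esymm σ ℚ 2 ^ 2 + 5 * esymm σ ℚ 1 ^ 2 * esymm σ ℚ 3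
      - 5 * esymm σ ℚ 2 * esymm σ ℚ 3 - 5 * esymm σ ℚ 1 * esymm σ ℚ 4 + 5 * esymm σ ℚ 5 := by
  have h1 : psum σ ℚ 1 = esymm σ ℚ 1 := by simp [psum, esymm_one]
  have h (k : ℕ) (hk : 0 < k) := psum_eq_mul_esymm_sub_sum σ ℚ k hk
  have h2 := h 2 (by simp)
  have h3 := h 3 (by simp)
  have h4 := h 4 (by simp)
  have h5 := h 5 (by simp)
  simp [Finset.sum_filter, Finset.Nat.antidiagonal_succ, h1] at h2 h3 h4 h5
  simp only [← esymm_one σ ℚ] at h2 h3 h4 h5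
  rw [h2] at h3 h4 h5
  rw [h3] at h4 h5
  rw [h4] at h5
  refine ⟨h1, ?_, ?_, ?_, ?_⟩
  · rw [h2]; ring
  · rw [h3]; ring
  · rw [h4]; ring
  · rw [h5]; ring

theorem chair_proper_iff {ι : Type*} (κ : Fin 5 → ι) :
    (∀ ⦃u v⦄, chairGraph.Adj u v → κ u ≠ κ v) ↔
      κ 0 ≠ κ 1 ∧ κ 4 ≠ κ 1 ∧ κ 2 ≠ κ 1 ∧ κ 3 ≠ κ 2 := by
  simp [Fin.forall_fin_succ, chairGraph, listGraph, SimpleGraph.fromRel_adj]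
  grind

theorem claw_proper_iff {ι : Type*} (κ : Fin 4 → ι) :
    (∀ ⦃u v⦄, clawGraph.Adj u v → κ u ≠ κ v) ↔ κ 1 ≠ κ 0 ∧ κ 2 ≠ κ 0 ∧ κ 3 ≠ κ 0 := by
  simp [Fin.forall_fin_succ, clawGraph, listGraph, SimpleGraph.fromRel_adj]
  grind

theorem hasInducedCopy_chair_claw : HasInducedCopy chairGraph clawGraph := by
  refine ⟨⟨![1, 0, 2, 4], by decide⟩, ?_⟩
  simp [Fin.forall_fin_succ, clawGraph, chairGraph, listGraph, SimpleGraph.fromRel_adj]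

theorem sum_ite_ne {ι R : Type*} [Fintype ι] [CommRing R] (x : ι → R) (b : ι) :
    (∑ a, if a ≠ b then x a else 0) = ∑ a, x a - x b := by
  rw [eq_sub_iff_add_eq, ← Finset.sum_filter, Finset.filter_ne', add_comm,
    Finset.add_sum_erase _ _ (Finset.mem_univ b)]

theorem csfPoly_chair (σ : Type*) [Fintype σ] :
    csfPoly σ chairGraph =
      MvPolynomial.esymm σ ℚ 2 * MvPolynomial.esymm σ ℚ 2 * MvPolynomial.esymm σ ℚ 1
        + 2 * (MvPolynomial.esymm σ ℚ 3 * MvPolynomial.esymm σ ℚ 1 * MvPolynomial.esymm σ ℚ 1)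
        + MvPolynomial.esymm σ ℚ 3 * MvPolynomial.esymm σ ℚ 2
        + 7 * (MvPolynomial.esymm σ ℚ 4 * MvPolynomial.esymm σ ℚ 1)
        + 5 * MvPolynomial.esymm σ ℚ 5 := by
  have hX : csfPoly σ chairGraph = ∑ b : σ,
      (∑ a, if a ≠ b then MvPolynomial.X a else 0) *
      ((∑ c, (if c ≠ b then MvPolynomial.X c else 0) *
        ∑ d, if d ≠ c then MvPolynomial.X d else 0) *
      ((∑ a, if a ≠ b then MvPolynomial.X a else 0) * MvPolynomial.X b)) := by
    simp only [csfPoly, chair_proper_iff, Fin.sum_pi_five]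
    rw [Finset.sum_comm]
    refine Finset.sum_congr rfl fun b _ => ?_
    rw [Finset.sum_mul]
    refine Finset.sum_congr rfl fun a _ => ?_
    rw [Finset.sum_mul, Finset.mul_sum]
    refine Finset.sum_congr rfl fun c _ => ?_
    rw [mul_assoc, Finset.sum_mul, Finset.mul_sum, Finset.mul_sum]
    refine Finset.sum_congr rfl fun d _ => ?_
    rw [Finset.sum_mul, Finset.mul_sum, Finset.mul_sum, Finset.mul_sum]
    refine Finset.sum_congr rfl fun e _ => ?_
    by_cases hab : a = b
    · simp [hab]
    by_cases heb : e = b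
    · simp [heb]
    by_cases hcb : c = b
    · simp [hcb]
    by_cases hdc : d = c
    · simp [hdc]
    simp [hab, heb, hcb, hdc, Fin.prod_univ_succ]
    ring
  have hS : ∀ k, ∑ a : σ, MvPolynomial.X a ^ k = MvPolynomial.psum σ ℚ k := fun k => rfl
  have hS1 : ∑ a : σ, MvPolynomial.X a = MvPolynomial.psum σ ℚ 1 := by simp [MvPolynomial.psum]
  have hS2 : ∑ c : σ, MvPolynomial.X c * (MvPolynomial.psum σ ℚ 1 - MvPolynomial.X c) =
      MvPolynomial.psum σ ℚ 1 ^ 2 - MvPolynomial.psum σ ℚ 2 := by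
    simp only [mul_sub, Finset.sum_sub_distrib, ← Finset.sum_mul, ← sq, hS, hS1]
  have hp : csfPoly σ chairGraph = ∑ b : σ,
      (MvPolynomial.X b * ((MvPolynomial.psum σ ℚ 1 ^ 2 - MvPolynomial.psum σ ℚ 2)
          * MvPolynomial.psum σ ℚ 1 ^ 2)
        - MvPolynomial.X b ^ 2 * (2 * (MvPolynomial.psum σ ℚ 1 ^ 2 - MvPolynomial.psum σ ℚ 2)
          * MvPolynomial.psum σ ℚ 1 + MvPolynomial.psum σ ℚ 1 ^ 3)
        + MvPolynomial.X b ^ 3 * (4 * MvPolynomial.psum σ ℚ 1 ^ 2 - MvPolynomial.psum σ ℚ 2)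
        - MvPolynomial.X b ^ 4 * (3 * MvPolynomial.psum σ ℚ 1)
        + MvPolynomial.X b ^ 5) := by
    rw [hX]
    refine Finset.sum_congr rfl fun b _ => ?_
    simp only [ite_mul, zero_mul, sum_ite_ne, hS1]
    rw [hS2]
    ring
  rw [hp]
  simp only [Finset.sum_sub_distrib, Finset.sum_add_distrib, ← Finset.sum_mul, hS, hS1]
  obtain ⟨h1, h2, h3, h4, h5⟩ := MvPolynomial.psum_eq_esymm σ
  rw [h5, h4, h3, h2, h1]
  ring

theorem ePositive_chair (h : csf chairGraph =
      esym 2 * esym 2 * esym 1 + 2 * (esym 3 * esym 1 * esym 1)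
        + esym 3 * esym 2 + 7 * (esym 4 * esym 1) + 5 * esym 5) :
    EPositive chairGraph := by
  let μ₁ : Nat.Partition (Fintype.card (Fin 5)) := ⟨{2, 2, 1}, by simp, by simp⟩
  let μ₂ : Nat.Partition (Fintype.card (Fin 5)) := ⟨{3, 1, 1}, by simp, by simp⟩
  let μ₃ : Nat.Partition (Fintype.card (Fin 5)) := ⟨{3, 2}, by simp, by simp⟩
  let μ₄ : Nat.Partition (Fintype.card (Fin 5)) := ⟨{4, 1}, by simp, by simp⟩
  let μ₅ : Nat.Partition (Fintype.card (Fin 5)) := ⟨{5}, by simp, by simp⟩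
  refine ⟨fun μ => (if μ = μ₁ then 1 else 0) + (if μ = μ₂ then 2 else 0)
    + (if μ = μ₃ then 1 else 0) + (if μ = μ₄ then 7 else 0) + (if μ = μ₅ then 5 else 0),
    fun μ => by positivity, ?_⟩
  simp only [add_smul, Finset.sum_add_distrib, ite_smul, zero_smul, Finset.sum_ite_eq',
    Finset.mem_univ, if_true]
  rw [h]
  simp [esymPart, μ₁, μ₂, μ₃, μ₄, μ₅, mul_assoc, ofNat_smul_eq_nsmul ℚ]

theorem csfPoly_claw (σ : Type*) [Fintype σ] :
    csfPoly σ clawGraph = ∑ b : σ, MvPolynomial.X b *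
      (∑ a, MvPolynomial.X a - MvPolynomial.X b) ^ 3 := by
  simp only [csfPoly, claw_proper_iff, Fin.sum_pi_four]
  refine Finset.sum_congr rfl fun b _ => ?_
  rw [← sum_ite_ne, pow_three, mul_comm, mul_assoc, mul_assoc, Finset.sum_mul]
  refine Finset.sum_congr rfl fun a _ => ?_
  rw [Finset.sum_mul, Finset.mul_sum]
  refine Finset.sum_congr rfl fun c _ => ?_
  rw [Finset.sum_mul, Finset.mul_sum, Finset.mul_sum]
  refine Finset.sum_congr rfl fun d _ => ?_
  by_cases hab : a = b
  · simp [hab]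
  by_cases hcb : c = b
  · simp [hcb]
  by_cases hdb : d = b
  · simp [hdb]
  simp [hab, hcb, hdb, Fin.prod_univ_succ]
  ring

theorem aeval_esymm_mem_rangeS (k : ℕ) :
    MvPolynomial.aeval (![1 + 2 * Complex.I, 1 - 2 * Complex.I] : Fin 2 → ℂ)
      (MvPolynomial.esymm (Fin 2) ℚ k) ∈ (algebraMap ℚ≥0 ℂ).rangeS := by
  have hI := Complex.I_sq
  match k with
  | 0 => exact ⟨1, by simp⟩
  | 1 => exact ⟨2, by simp [MvPolynomial.esymm_one]; ring⟩
  | 2 =>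
    refine ⟨5, ?_⟩
    have : Finset.powersetCard 2 (univ : Finset (Fin 2)) = {univ} := by decide
    simp [MvPolynomial.esymm, this]
    linear_combination 4 * hI
  | k + 3 =>
    refine ⟨0, ?_⟩
    rw [MvPolynomial.esymm, Finset.powersetCard_eq_empty.2 (by simp)]
    simp

theorem not_ePositive_claw : ¬ EPositive clawGraph := by
  rintro ⟨c, hc, h⟩
  have hp : csfPoly (Fin 2) clawGraph =
      ∑ μ, c μ • (μ.parts.map (MvPolynomial.esymm (Fin 2) ℚ)).prod := by
    apply MvPolynomial.coe_injective
    rw [← killCompl_csf clawGraph Fin.valEmbedding, h, map_sum,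
      ← MvPolynomial.coeToMvPowerSeries.ringHom_apply, map_sum]
    refine Finset.sum_congr rfl fun μ _ => ?_
    rw [map_smul, esymPart, map_multiset_prod, Multiset.map_map,
      MvPolynomial.coeToMvPowerSeries.ringHom_apply, MvPolynomial.coe_smul,
      ← MvPolynomial.coeToMvPowerSeries.ringHom_apply, map_multiset_prod, Multiset.map_map]
    simp [Function.comp_def, killCompl_esym]
  have hmem : MvPolynomial.aeval (![1 + 2 * Complex.I, 1 - 2 * Complex.I] : Fin 2 → ℂ)
      (csfPoly (Fin 2) clawGraph) ∈ (algebraMap ℚ≥0 ℂ).rangeS := by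
    rw [hp, map_sum]
    refine sum_mem fun μ _ => ?_
    rw [map_smul, Algebra.smul_def, map_multiset_prod, Multiset.map_map]
    refine mul_mem ⟨⟨c μ, hc μ⟩, IsScalarTower.algebraMap_apply ℚ≥0 ℚ ℂ (⟨c μ, hc μ⟩ : ℚ≥0)⟩
      (multiset_prod_mem _ fun x hx => ?_)
    obtain ⟨k, -, rfl⟩ := Multiset.mem_map.1 hx
    exact aeval_esymm_mem_rangeS k
  have hval : MvPolynomial.aeval (![1 + 2 * Complex.I, 1 - 2 * Complex.I] : Fin 2 → ℂ)
      (csfPoly (Fin 2) clawGraph) = -30 := by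
    simp [csfPoly_claw]
    ring_nf
    simp [Complex.I_pow_four]
    norm_num
  rw [hval] at hmem
  obtain ⟨q, hq⟩ := hmem
  have hq' : ((q : ℝ) : ℂ) = ((-30 : ℝ) : ℂ) := by simpa using hq
  have : (q : ℝ) = -30 := by exact_mod_cast hq'
  have h0 : (0 : ℝ) ≤ q := by positivity
  linarith

theorem csf_chair_eq :
    csf chairGraph =
      esym 2 * esym 2 * esym 1 + 2 * (esym 3 * esym 1 * esym 1)
        + esym 3 * esym 2 + 7 * (esym 4 * esym 1) + 5 * esym 5 := by
  refine MvPowerSeries.ext_killCompl fun N => ?_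
  simp only [killCompl_csf, csfPoly_chair, map_add, map_mul, map_ofNat, killCompl_esym,
    ← MvPolynomial.coeToMvPowerSeries.ringHom_apply]

/-- `X_chair = e_{2,2,1} + 2 e_{3,1,1} + e_{3,2} + 7 e_{4,1} + 5 e_5`; in
particular the chair is `e`-positive even though it contains an induced claw
(which is not `e`-positive), so `e`-positivity is not hereditary. -/
theorem csf_chair :
    csf chairGraph =
      esym 2 * esym 2 * esym 1 + 2 * (esym 3 * esym 1 * esym 1)
        + esym 3 * esym 2 + 7 * (esym 4 * esym 1) + 5 * esym 5 ∧
    EPositive chairGraph ∧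
    HasInducedCopy chairGraph clawGraph ∧
    ¬ EPositive clawGraph := by
  exact ⟨csf_chair_eq, ePositive_chair csf_chair_eq, hasInducedCopy_chair_claw, not_ePositive_claw⟩
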